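/- Equivalence of time-uniform guarantees: Let (A_t)_{t≥1} be an adapted sequence of events in a filtered probability space, and let A_∞ := limsup_{t→∞} A_t. For α ∈ (0,1) the following are equivalent: (a) P(∪_{t=1}^∞ A_t) ≤ α; (b) P(A_T) ≤ α for every random time T taking values in ℕ ∪ {∞} (not necessarily a stopping time), where A_T := ∪_{t∈ℕ} (A_t ∩ {T = t}) ∪ (A_∞ ∩ {T = ∞}); (c) P(A_τ) ≤ α for every stopping time τ with respect to the filtration, possibly taking the value ∞. -/

import Mathlib

open MeasureTheory ProbabilityTheory Filter Set

noncomputable section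

/-- There is a first-entry time: the first `t ≥ 1` with `ω ∈ A t`, or `⊤` if there is none. -/
theorem exists_firstEntry {Ω : Type*} (A : ℕ → Set Ω) :
    ∃ τ : Ω → ℕ∞, ∀ (ω : Ω) (t : ℕ), τ ω = (t : ℕ∞) ↔
      (1 ≤ t ∧ ω ∈ A t) ∧ ∀ s < t, ¬(1 ≤ s ∧ ω ∈ A s) := by
  classical
  refine ⟨fun ω => if h : ∃ t, 1 ≤ t ∧ ω ∈ A t then (Nat.find h : ℕ∞) else ⊤, fun ω t => ?_⟩
  by_cases h : ∃ t, 1 ≤ t ∧ ω ∈ A t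
  · simp only [dif_pos h, Nat.cast_inj, Nat.find_eq_iff]
  · simp only [dif_neg h]
    exact ⟨fun h' => absurd h' (ENat.top_ne_natCast t), fun h' => absurd ⟨t, h'.1⟩ h⟩

/-- The event `A_T` is contained in the union of the events `A t`, `t ≥ 1`. -/
theorem event_at_time_subset_iUnion {Ω : Type*} (A : ℕ → Set Ω) (T : Ω → ℕ∞) :
    {ω | ∃ t : ℕ, 1 ≤ t ∧ T ω = (t : ℕ∞) ∧ ω ∈ A t}
      ∪ {ω | T ω = ⊤ ∧ ω ∈ Filter.limsup A Filter.atTop} ⊆ ⋃ t : ℕ, ⋃ (_ : 1 ≤ t), A t := by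
  rintro ω (⟨t, ht, -, hω⟩ | ⟨-, hω⟩)
  · exact mem_iUnion₂.2 ⟨t, ht, hω⟩
  · rw [mem_limsup_iff_frequently_mem] at hω
    obtain ⟨t, ht, hωt⟩ := frequently_atTop.1 hω 1
    exact mem_iUnion₂.2 ⟨t, ht, hωt⟩

/-- Some stopping time (the first entry time) takes a finite value `t ≥ 1` with `ω ∈ A t` at every
`ω` in the union of the events `A t`, `t ≥ 1`. -/
theorem exists_stoppingTime_iUnion_subset {Ω : Type*} {mΩ : MeasurableSpace Ω}
    (F : Filtration ℕ mΩ) (A : ℕ → Set Ω) (hA : ∀ t : ℕ, MeasurableSet[F t] (A t)) :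
    ∃ τ : Ω → ℕ∞, (∀ t : ℕ, MeasurableSet[F t] {ω | τ ω = (t : ℕ∞)}) ∧
      ⋃ t : ℕ, ⋃ (_ : 1 ≤ t), A t ⊆ {ω | ∃ t : ℕ, 1 ≤ t ∧ τ ω = (t : ℕ∞) ∧ ω ∈ A t} := by
  classical
  obtain ⟨τ, hτ⟩ := exists_firstEntry A
  refine ⟨τ, fun t => ?_, fun ω hω => ?_⟩
  · have hmeas : ∀ s ≤ t, MeasurableSet[F t] {ω | 1 ≤ s ∧ ω ∈ A s} := fun s hs =>
      (MeasurableSet.const (1 ≤ s)).inter (F.mono hs _ (hA s))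
    have heq : {ω | τ ω = (t : ℕ∞)} =
        {ω | 1 ≤ t ∧ ω ∈ A t} ∩ ⋂ s : ℕ, ⋂ (_ : s < t), {ω | 1 ≤ s ∧ ω ∈ A s}ᶜ := by
      ext ω
      simp only [mem_ofPred_eq, hτ, mem_inter_iff, mem_iInter, mem_compl_iff]
    rw [heq]
    exact (hmeas t le_rfl).inter
      (MeasurableSet.iInter fun s => MeasurableSet.iInter fun hs => (hmeas s hs.le).compl)
  · have h : ∃ t, 1 ≤ t ∧ ω ∈ A t := by simpa using hω
    have hfind := Nat.find_spec h
    exact ⟨Nat.find h, hfind.1, (hτ ω _).2 ⟨hfind, fun s hs => Nat.find_min h hs⟩, hfind.2⟩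

/-- The level sets of an extended-natural-valued time are measurable, including at `⊤`, as soon as
the finite ones are. -/
theorem measurableSet_eq_of_forall_coe {Ω : Type*} [MeasurableSpace Ω] {T : Ω → ℕ∞}
    (hT : ∀ t : ℕ, MeasurableSet {ω | T ω = (t : ℕ∞)}) (n : ℕ∞) :
    MeasurableSet {ω | T ω = n} := by
  induction n using ENat.recTopCoe with
  | coe t => exact hT t
  | top =>
    have heq : {ω | T ω = ⊤} = (⋃ t : ℕ, {ω | T ω = (t : ℕ∞)})ᶜ := by
      ext ω
      simp only [mem_ofPred_eq, mem_compl_iff, mem_iUnion, ← ENat.ne_top_iff_exists.trans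
        (exists_congr fun _ => eq_comm), not_not]
    rw [heq]
    exact (MeasurableSet.iUnion hT).compl

/-- Lemma 3 (equivalence of time-uniform guarantees): for an adapted sequence of events
`(A_t)_{t≥1}` with `A_∞ = limsup_t A_t`, the following are equivalent:
(a) `P(∪_{t≥1} A_t) ≤ α`;
(b) `P(A_T) ≤ α` for every random time `T : Ω → ℕ ∪ {∞}`;
(c) `P(A_τ) ≤ α` for every stopping time `τ : Ω → ℕ ∪ {∞}`. -/
theorem time_uniform_equivalences
    {Ω : Type*} {mΩ : MeasurableSpace Ω} (P : Measure Ω) [IsProbabilityMeasure P]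
    (F : Filtration ℕ mΩ) (A : ℕ → Set Ω)
    (hA : ∀ t : ℕ, MeasurableSet[F t] (A t))
    (α : ℝ) (hα : α ∈ Set.Ioo (0 : ℝ) 1) :
    -- (a) ↔ (b)
    ((P (⋃ t : ℕ, ⋃ (_ : 1 ≤ t), A t) ≤ ENNReal.ofReal α) ↔
      (∀ T : Ω → ℕ∞, (∀ n : ℕ∞, MeasurableSet {ω | T ω = n}) →
        P ({ω | ∃ t : ℕ, 1 ≤ t ∧ T ω = (t : ℕ∞) ∧ ω ∈ A t}
            ∪ {ω | T ω = ⊤ ∧ ω ∈ Filter.limsup A Filter.atTop})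
          ≤ ENNReal.ofReal α)) ∧
    -- (a) ↔ (c)
    ((P (⋃ t : ℕ, ⋃ (_ : 1 ≤ t), A t) ≤ ENNReal.ofReal α) ↔
      (∀ τ : Ω → ℕ∞, (∀ t : ℕ, MeasurableSet[F t] {ω | τ ω = (t : ℕ∞)}) →
        P ({ω | ∃ t : ℕ, 1 ≤ t ∧ τ ω = (t : ℕ∞) ∧ ω ∈ A t}
            ∪ {ω | τ ω = ⊤ ∧ ω ∈ Filter.limsup A Filter.atTop})
          ≤ ENNReal.ofReal α)) := by
  obtain ⟨τ, hτ, hsub⟩ := exists_stoppingTime_iUnion_subset F A hA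
  have hle := measure_mono (μ := P) (hsub.trans
    (subset_union_left (t := {ω | τ ω = ⊤ ∧ ω ∈ Filter.limsup A Filter.atTop})))
  refine ⟨⟨fun h T _ => (measure_mono (event_at_time_subset_iUnion A T)).trans h, fun h => ?_⟩,
    ⟨fun h T _ => (measure_mono (event_at_time_subset_iUnion A T)).trans h, fun h => ?_⟩⟩
  · exact hle.trans (h τ (measurableSet_eq_of_forall_coe fun t => F.le t _ (hτ t)))
  · exact hle.trans (h τ hτ)
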